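/- Let $f: \mathbb{R}^3 \to \mathbb{R}$ be smooth. Then for $R \ge 1$, $\sup_{R/2 < |x| < R} |f(x)| \le C R^{-1} \sum_{|\alpha|+|\beta| \le 2} \|\Omega^\alpha \partial_x^\beta f\|_{L^2(R/4 < |x| < 2R)}$, where $\Omega = x\times\nabla$ are the rotation vector fields and $C$ is an absolute constant. -/

import Mathlib

/-- Partial derivative in the `i`-th coordinate direction on `ℝ³`. -/
noncomputable def pdE (i : Fin 3) (f : EuclideanSpace ℝ (Fin 3) → ℝ) :
    EuclideanSpace ℝ (Fin 3) → ℝ :=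
  fun x => fderiv ℝ f x (EuclideanSpace.single i 1)

/-- The rotation vector field `Ω_l = (x × ∇)_l`, acting on scalar functions. -/
noncomputable def rotE (l : Fin 3) (f : EuclideanSpace ℝ (Fin 3) → ℝ) :
    EuclideanSpace ℝ (Fin 3) → ℝ :=
  fun x => x (l + 1) * pdE (l + 2) f x - x (l + 2) * pdE (l + 1) f x

/-- `Ω^α f = Ω₁^{α₁} Ω₂^{α₂} Ω₃^{α₃} f` for a multi-index `α`. -/
noncomputable def rotPow (α : Fin 3 → ℕ) (f : EuclideanSpace ℝ (Fin 3) → ℝ) :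
    EuclideanSpace ℝ (Fin 3) → ℝ :=
  (rotE 0)^[α 0] ((rotE 1)^[α 1] ((rotE 2)^[α 2] f))

/-- `∂^β f = ∂₁^{β₁} ∂₂^{β₂} ∂₃^{β₃} f` for a multi-index `β`. -/
noncomputable def pdPow (β : Fin 3 → ℕ) (f : EuclideanSpace ℝ (Fin 3) → ℝ) :
    EuclideanSpace ℝ (Fin 3) → ℝ :=
  (pdE 0)^[β 0] ((pdE 1)^[β 1] ((pdE 2)^[β 2] f))

section VectorFields

variable {f : EuclideanSpace ℝ (Fin 3) → ℝ}

lemma contDiff_pdE (hf : ContDiff ℝ (⊤ : ℕ∞) f) (i : Fin 3) :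
    ContDiff ℝ (⊤ : ℕ∞) (pdE i f) :=
  (hf.fderiv_right (m := (⊤ : ℕ∞)) (by simp)).clm_apply contDiff_const

lemma contDiff_rotE (hf : ContDiff ℝ (⊤ : ℕ∞) f) (l : Fin 3) :
    ContDiff ℝ (⊤ : ℕ∞) (rotE l f) := by
  have h (i : Fin 3) : ContDiff ℝ (⊤ : ℕ∞) (fun x : EuclideanSpace ℝ (Fin 3) => x i) := by
    fun_prop
  exact ((h _).mul (contDiff_pdE hf _)).sub ((h _).mul (contDiff_pdE hf _))

lemma fderiv_eq_sum_pdE (f : EuclideanSpace ℝ (Fin 3) → ℝ) (y v : EuclideanSpace ℝ (Fin 3)) :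
    fderiv ℝ f y v = ∑ i, v i * pdE i f y := by
  conv_lhs => rw [← (EuclideanSpace.basisFun (Fin 3) ℝ).sum_repr v]
  simp [pdE]

lemma pdE_comm (hf : ContDiff ℝ (⊤ : ℕ∞) f) (i j : Fin 3) (x : EuclideanSpace ℝ (Fin 3)) :
    pdE i (pdE j f) x = pdE j (pdE i f) x := by
  have hs : IsSymmSndFDerivAt ℝ f x :=
    hf.contDiffAt.isSymmSndFDerivAt (by
      rw [minSmoothness_of_isRCLikeNormedField]
      exact WithTop.coe_le_coe.2 (le_top : (2 : ℕ∞) ≤ ⊤))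
  have hd : DifferentiableAt ℝ (fderiv ℝ f) x :=
    ((hf.fderiv_right (m := (⊤ : ℕ∞)) (by simp)).differentiable (by simp)) x
  have key (a b : EuclideanSpace ℝ (Fin 3)) :
      fderiv ℝ (fun y => fderiv ℝ f y b) x a = fderiv ℝ (fderiv ℝ f) x a b := by
    rw [fderiv_clm_apply hd (differentiableAt_const _)]
    simp
  exact (key _ _).trans ((hs _ _).trans (key _ _).symm)

lemma pdE_rotE (hf : ContDiff ℝ (⊤ : ℕ∞) f) (j l : Fin 3) (x : EuclideanSpace ℝ (Fin 3)) :
    pdE j (rotE l f) x = rotE l (pdE j f) x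
      + ((if l + 1 = j then pdE (l + 2) f x else 0)
        - (if l + 2 = j then pdE (l + 1) f x else 0)) := by
  have hd (i : Fin 3) : DifferentiableAt ℝ (pdE i f) x := (contDiff_pdE hf i).differentiable (by simp) x
  have hc (i : Fin 3) : HasFDerivAt (fun y : EuclideanSpace ℝ (Fin 3) => y i)
      (EuclideanSpace.proj i : EuclideanSpace ℝ (Fin 3) →L[ℝ] ℝ) x :=
    (EuclideanSpace.proj i : EuclideanSpace ℝ (Fin 3) →L[ℝ] ℝ).hasFDerivAt
  have h := ((hc (l + 1)).mul (hd (l + 2)).hasFDerivAt).sub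
    ((hc (l + 2)).mul (hd (l + 1)).hasFDerivAt)
  have h' : fderiv ℝ (rotE l f) x = _ := h.fderiv
  have e1 := pdE_comm hf j (l + 1) x
  have e2 := pdE_comm hf j (l + 2) x
  rw [pdE, h', rotE, ← e1, ← e2]
  simp only [pdE, sub_apply, add_apply, smul_apply, EuclideanSpace.coe_proj, PiLp.single_apply, smul_eq_mul,
    mul_ite, mul_one, mul_zero]
  ring

lemma rotE_add_one_rotE (hf : ContDiff ℝ (⊤ : ℕ∞) f) (l : Fin 3)
    (x : EuclideanSpace ℝ (Fin 3)) :
    rotE (l + 1) (rotE l f) x = rotE l (rotE (l + 1) f) x + rotE (l + 2) f x := by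
  simp only [rotE.eq_1 _ (rotE _ f), pdE_rotE hf]
  simp only [rotE]
  have c := pdE_comm hf
  fin_cases l <;> simp <;> simp only [c 1 0, c 2 0, c 2 1] <;> ring

end VectorFields

section Energy

/-- The multi-index pairs `(α, β)` of total order at most two. -/
def orderLeTwo : Finset ((Fin 3 → Fin 3) × (Fin 3 → Fin 3)) :=
  Finset.univ.filter (fun p => (∑ i, (p.1 i : ℕ)) + (∑ i, (p.2 i : ℕ)) ≤ 2)

/-- The operator `Ω^α ∂^β` for a pair of multi-indices. -/
noncomputable def rotPdPow (p : (Fin 3 → Fin 3) × (Fin 3 → Fin 3))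
    (f : EuclideanSpace ℝ (Fin 3) → ℝ) : EuclideanSpace ℝ (Fin 3) → ℝ :=
  rotPow (fun i => (p.1 i : ℕ)) (pdPow (fun i => (p.2 i : ℕ)) f)

/-- The pointwise sum `∑ |Ω^α ∂^β f|` over total order at most two. -/
noncomputable def pointEnergy (f : EuclideanSpace ℝ (Fin 3) → ℝ)
    (y : EuclideanSpace ℝ (Fin 3)) : ℝ :=
  ∑ p ∈ orderLeTwo, |rotPdPow p f y|

variable {f : EuclideanSpace ℝ (Fin 3) → ℝ}

lemma contDiff_rotPdPow (hf : ContDiff ℝ (⊤ : ℕ∞) f)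
    (p : (Fin 3 → Fin 3) × (Fin 3 → Fin 3)) : ContDiff ℝ (⊤ : ℕ∞) (rotPdPow p f) := by
  have hp (i : Fin 3) (n : ℕ) {h : EuclideanSpace ℝ (Fin 3) → ℝ}
      (hh : ContDiff ℝ (⊤ : ℕ∞) h) : ContDiff ℝ (⊤ : ℕ∞) ((pdE i)^[n] h) :=
    Function.Iterate.rec _ hh (fun _ h' => contDiff_pdE h' i) n
  have hr (i : Fin 3) (n : ℕ) {h : EuclideanSpace ℝ (Fin 3) → ℝ}
      (hh : ContDiff ℝ (⊤ : ℕ∞) h) : ContDiff ℝ (⊤ : ℕ∞) ((rotE i)^[n] h) :=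
    Function.Iterate.rec _ hh (fun _ h' => contDiff_rotE h' i) n
  exact hr _ _ (hr _ _ (hr _ _ (hp _ _ (hp _ _ (hp _ _ hf)))))

lemma continuous_pointEnergy (hf : ContDiff ℝ (⊤ : ℕ∞) f) : Continuous (pointEnergy f) :=
  continuous_finsetSum _ fun p _ => (contDiff_rotPdPow hf p).continuous.abs

lemma pointEnergy_nonneg (f : EuclideanSpace ℝ (Fin 3) → ℝ) (y : EuclideanSpace ℝ (Fin 3)) :
    0 ≤ pointEnergy f y :=
  Finset.sum_nonneg fun _ _ => abs_nonneg _

variable (f) (y : EuclideanSpace ℝ (Fin 3))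

lemma abs_rotPdPow_le (p : (Fin 3 → Fin 3) × (Fin 3 → Fin 3)) (hp : p ∈ orderLeTwo) :
    |rotPdPow p f y| ≤ pointEnergy f y :=
  Finset.single_le_sum (f := fun p => |rotPdPow p f y|) (fun _ _ => abs_nonneg _) hp

lemma abs_le_pointEnergy : |f y| ≤ pointEnergy f y := by
  simpa [rotPdPow, rotPow, pdPow] using
    abs_rotPdPow_le f y (![0, 0, 0], ![0, 0, 0]) (by decide)

lemma abs_pdE_le (i : Fin 3) : |pdE i f y| ≤ pointEnergy f y := by
  have h := abs_rotPdPow_le f y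
  fin_cases i
  · simpa [rotPdPow, rotPow, pdPow] using h (![0, 0, 0], ![1, 0, 0]) (by decide)
  · simpa [rotPdPow, rotPow, pdPow] using h (![0, 0, 0], ![0, 1, 0]) (by decide)
  · simpa [rotPdPow, rotPow, pdPow] using h (![0, 0, 0], ![0, 0, 1]) (by decide)

lemma abs_rotE_le (i : Fin 3) : |rotE i f y| ≤ pointEnergy f y := by
  have h := abs_rotPdPow_le f y
  fin_cases i
  · simpa [rotPdPow, rotPow, pdPow] using h (![1, 0, 0], ![0, 0, 0]) (by decide)
  · simpa [rotPdPow, rotPow, pdPow] using h (![0, 1, 0], ![0, 0, 0]) (by decide)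
  · simpa [rotPdPow, rotPow, pdPow] using h (![0, 0, 1], ![0, 0, 0]) (by decide)

lemma abs_rotE_pdE_le (l i : Fin 3) : |rotE l (pdE i f) y| ≤ pointEnergy f y := by
  have h := abs_rotPdPow_le f y
  fin_cases l <;> fin_cases i
  · simpa [rotPdPow, rotPow, pdPow] using h (![1, 0, 0], ![1, 0, 0]) (by decide)
  · simpa [rotPdPow, rotPow, pdPow] using h (![1, 0, 0], ![0, 1, 0]) (by decide)
  · simpa [rotPdPow, rotPow, pdPow] using h (![1, 0, 0], ![0, 0, 1]) (by decide)
  · simpa [rotPdPow, rotPow, pdPow] using h (![0, 1, 0], ![1, 0, 0]) (by decide)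
  · simpa [rotPdPow, rotPow, pdPow] using h (![0, 1, 0], ![0, 1, 0]) (by decide)
  · simpa [rotPdPow, rotPow, pdPow] using h (![0, 1, 0], ![0, 0, 1]) (by decide)
  · simpa [rotPdPow, rotPow, pdPow] using h (![0, 0, 1], ![1, 0, 0]) (by decide)
  · simpa [rotPdPow, rotPow, pdPow] using h (![0, 0, 1], ![0, 1, 0]) (by decide)
  · simpa [rotPdPow, rotPow, pdPow] using h (![0, 0, 1], ![0, 0, 1]) (by decide)

variable {f}

lemma abs_pdE_pdE_le (hf : ContDiff ℝ (⊤ : ℕ∞) f) (i j : Fin 3) :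
    |pdE i (pdE j f) y| ≤ pointEnergy f y := by
  wlog hij : i ≤ j generalizing i j
  · rw [pdE_comm hf]
    exact this j i (le_of_not_ge hij)
  have h := abs_rotPdPow_le f y
  fin_cases i <;> fin_cases j
  · simpa [rotPdPow, rotPow, pdPow] using h (![0, 0, 0], ![2, 0, 0]) (by decide)
  · simpa [rotPdPow, rotPow, pdPow] using h (![0, 0, 0], ![1, 1, 0]) (by decide)
  · simpa [rotPdPow, rotPow, pdPow] using h (![0, 0, 0], ![1, 0, 1]) (by decide)
  · simp at hij
  · simpa [rotPdPow, rotPow, pdPow] using h (![0, 0, 0], ![0, 2, 0]) (by decide)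
  · simpa [rotPdPow, rotPow, pdPow] using h (![0, 0, 0], ![0, 1, 1]) (by decide)
  · simp at hij
  · exact absurd hij (by decide)
  · simpa [rotPdPow, rotPow, pdPow] using h (![0, 0, 0], ![0, 0, 2]) (by decide)

lemma abs_pdE_rotE_le (hf : ContDiff ℝ (⊤ : ℕ∞) f) (i l : Fin 3) :
    |pdE i (rotE l f) y| ≤ 3 * pointEnergy f y := by
  rw [pdE_rotE hf]
  have h0 := abs_le.1 (abs_rotE_pdE_le f y l i)
  have h1 := abs_le.1 (abs_pdE_le f y (l + 2))
  have h2 := abs_le.1 (abs_pdE_le f y (l + 1))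
  rw [abs_le]
  split_ifs <;> constructor <;> linarith

lemma abs_rotE_rotE_le (hf : ContDiff ℝ (⊤ : ℕ∞) f) (m l : Fin 3) :
    |rotE m (rotE l f) y| ≤ 3 * pointEnergy f y := by
  have h := abs_rotPdPow_le f y
  have h01 : |rotE 0 (rotE 1 f) y| ≤ pointEnergy f y := by
    simpa [rotPdPow, rotPow, pdPow] using h (![1, 1, 0], ![0, 0, 0]) (by decide)
  have h02 : |rotE 0 (rotE 2 f) y| ≤ pointEnergy f y := by
    simpa [rotPdPow, rotPow, pdPow] using h (![1, 0, 1], ![0, 0, 0]) (by decide)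
  have h12 : |rotE 1 (rotE 2 f) y| ≤ pointEnergy f y := by
    simpa [rotPdPow, rotPow, pdPow] using h (![0, 1, 1], ![0, 0, 0]) (by decide)
  have h00 : |rotE 0 (rotE 0 f) y| ≤ pointEnergy f y := by
    simpa [rotPdPow, rotPow, pdPow] using h (![2, 0, 0], ![0, 0, 0]) (by decide)
  have h11 : |rotE 1 (rotE 1 f) y| ≤ pointEnergy f y := by
    simpa [rotPdPow, rotPow, pdPow] using h (![0, 2, 0], ![0, 0, 0]) (by decide)
  have h22 : |rotE 2 (rotE 2 f) y| ≤ pointEnergy f y := by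
    simpa [rotPdPow, rotPow, pdPow] using h (![0, 0, 2], ![0, 0, 0]) (by decide)
  have c0 : rotE 1 (rotE 0 f) y = rotE 0 (rotE 1 f) y + rotE 2 f y := rotE_add_one_rotE hf 0 y
  have c1 : rotE 2 (rotE 1 f) y = rotE 1 (rotE 2 f) y + rotE 0 f y := rotE_add_one_rotE hf 1 y
  have c2 : rotE 0 (rotE 2 f) y = rotE 2 (rotE 0 f) y + rotE 1 f y := rotE_add_one_rotE hf 2 y
  have r0 := abs_le.1 (abs_rotE_le f y 0)
  have r1 := abs_le.1 (abs_rotE_le f y 1)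
  have r2 := abs_le.1 (abs_rotE_le f y 2)
  rw [abs_le] at *
  fin_cases m <;> fin_cases l <;> simp only [Fin.zero_eta, Fin.mk_one, Fin.reduceFinMk] <;>
    constructor <;> linarith

end Energy

section Curves

/-- The cross product `v × w`, in coordinates. -/
def crossE (v w : EuclideanSpace ℝ (Fin 3)) (l : Fin 3) : ℝ :=
  v (l + 1) * w (l + 2) - v (l + 2) * w (l + 1)

lemma abs_crossE_le {v w : EuclideanSpace ℝ (Fin 3)} {K : ℝ} (hv : ‖v‖ = 1) (hw : ‖w‖ ≤ K)
    (l : Fin 3) : |crossE v w l| ≤ 2 * K := by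
  have hv' (i : Fin 3) : |v i| ≤ 1 := hv ▸ PiLp.norm_apply_le v i
  have hw' (i : Fin 3) : |w i| ≤ K := (PiLp.norm_apply_le w i).trans hw
  have h (i j : Fin 3) : |v i * w j| ≤ K := by
    rw [abs_mul]
    nlinarith [hv' i, hw' j, abs_nonneg (v i), abs_nonneg (w j)]
  have h1 := abs_le.1 (h (l + 1) (l + 2))
  have h2 := abs_le.1 (h (l + 2) (l + 1))
  rw [crossE, abs_le]
  constructor <;> linarith

lemma sum_mul_abs_le {a b : Fin 3 → ℝ} {A B : ℝ} (ha : ∀ i, |a i| ≤ A) (hb : ∀ i, |b i| ≤ B) :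
    |∑ i, a i * b i| ≤ 3 * (A * B) := by
  have h (i : Fin 3) : |a i * b i| ≤ A * B := by
    rw [abs_mul]
    exact mul_le_mul (ha i) (hb i) (abs_nonneg _) ((abs_nonneg _).trans (ha i))
  exact (Finset.abs_sum_le_sum_abs _ _).trans
    ((Finset.sum_le_sum fun i _ => h i).trans (by simp))

/-- The derivative of `h` at `y` along a curve with direction `v`, radial speed `t` and angular
velocity `v × v'`, expressed through `∂_i h` and `Ω_l h`. -/
noncomputable def curveDeriv (t : ℝ) (v v' : EuclideanSpace ℝ (Fin 3))
    (h : EuclideanSpace ℝ (Fin 3) → ℝ) (y : EuclideanSpace ℝ (Fin 3)) : ℝ :=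
  t * (∑ i, v i * pdE i h y) + ∑ l, crossE v v' l * rotE l h y

lemma abs_curveDeriv_le {t K W : ℝ} {v v' y : EuclideanSpace ℝ (Fin 3)}
    {h : EuclideanSpace ℝ (Fin 3) → ℝ} (ht : |t| ≤ 1) (hv : ‖v‖ = 1) (hv' : ‖v'‖ ≤ K)
    (hp : ∀ i, |pdE i h y| ≤ W) (hr : ∀ l, |rotE l h y| ≤ W) :
    |curveDeriv t v v' h y| ≤ 3 * W + 3 * (2 * K * W) := by
  have h1 : |∑ i, v i * pdE i h y| ≤ 3 * (1 * W) :=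
    sum_mul_abs_le (fun i => hv ▸ PiLp.norm_apply_le v i) hp
  have h2 := sum_mul_abs_le (abs_crossE_le hv hv') hr
  refine (abs_add_le _ _).trans (add_le_add ?_ h2)
  rw [abs_mul]
  nlinarith [abs_nonneg t, abs_nonneg (∑ i, v i * pdE i h y)]

variable {ω ω' ω'' : ℝ → EuclideanSpace ℝ (Fin 3)} {r t s : ℝ}

lemma HasDerivAt.euclidean_apply {v : EuclideanSpace ℝ (Fin 3)} (h : HasDerivAt ω v s)
    (i : Fin 3) : HasDerivAt (fun s => ω s i) (v i) s :=
  (EuclideanSpace.proj i : EuclideanSpace ℝ (Fin 3) →L[ℝ] ℝ).hasFDerivAt.comp_hasDerivAt s h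

lemma hasDerivAt_comp_curve {h : EuclideanSpace ℝ (Fin 3) → ℝ} (hh : Differentiable ℝ h)
    (hω : HasDerivAt ω (ω' s) s) (hn : ∀ s, ‖ω s‖ = 1) :
    HasDerivAt (fun s => h ((r + s * t) • ω s))
      (curveDeriv t (ω s) (ω' s) h ((r + s * t) • ω s)) s := by
  have hρ : HasDerivAt (fun s : ℝ => r + s * t) t s := by
    simpa using ((hasDerivAt_id s).mul_const t).const_add r
  have hc := (hh ((r + s * t) • ω s)).hasFDerivAt.comp_hasDerivAt s (hρ.smul hω)
  refine hc.congr_deriv ?_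
  have hsq (s : ℝ) : ω s 0 ^ 2 + ω s 1 ^ 2 + ω s 2 ^ 2 = 1 := by
    have := EuclideanSpace.real_norm_sq_eq (ω s)
    rw [hn, Fin.sum_univ_three] at this
    linarith
  have horth : ω s 0 * ω' s 0 + ω s 1 * ω' s 1 + ω s 2 * ω' s 2 = 0 := by
    have hd := (((hω.euclidean_apply 0).pow 2).add ((hω.euclidean_apply 1).pow 2)).add
      ((hω.euclidean_apply 2).pow 2)
    have h1 := hd.unique ((hasDerivAt_const s (1 : ℝ)).congr_of_eventuallyEq
      (Filter.Eventually.of_forall hsq))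
    simp only [Nat.cast_ofNat, Nat.add_one_sub_one, pow_one] at h1
    linarith
  rw [fderiv_eq_sum_pdE]
  simp only [curveDeriv, crossE, rotE, Fin.sum_univ_three, PiLp.add_apply, PiLp.smul_apply,
    smul_eq_mul, zero_add, Fin.reduceAdd]
  generalize pdE 0 h _ = p0
  generalize pdE 1 h _ = p1
  generalize pdE 2 h _ = p2
  have hs := hsq s
  linear_combination (-(r + s * t) * (ω' s 0 * p0 + ω' s 1 * p1 + ω' s 2 * p2)) * hs
    + ((r + s * t) * (ω s 0 * p0 + ω s 1 * p1 + ω s 2 * p2)) * horth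

lemma exists_second_deriv_along_curve {f : EuclideanSpace ℝ (Fin 3) → ℝ}
    (hf : ContDiff ℝ (⊤ : ℕ∞) f) (ht : |t| ≤ 1)
    (hω : HasDerivAt ω (ω' s) s) (hω' : HasDerivAt ω' (ω'' s) s) (hn : ∀ s, ‖ω s‖ = 1)
    (h1 : ‖ω' s‖ ≤ 2) (h2 : ‖ω'' s‖ ≤ 2) :
    ∃ D, HasDerivAt (fun s => curveDeriv t (ω s) (ω' s) f ((r + s * t) • ω s)) D s ∧
      |D| ≤ 1000 * pointEnergy f ((r + s * t) • ω s) := by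
  set y := (r + s * t) • ω s with hy
  set G := pointEnergy f y with hG
  have hG0 : 0 ≤ G := pointEnergy_nonneg f y
  have hp (i : Fin 3) := ((hω.euclidean_apply i).mul (hasDerivAt_comp_curve (r := r) (t := t)
    ((contDiff_pdE hf i).differentiable (by simp)) hω hn))
  have hcr (l : Fin 3) : HasDerivAt (fun s => crossE (ω s) (ω' s) l)
      (crossE (ω s) (ω'' s) l) s := by
    refine (((hω.euclidean_apply (l + 1)).mul (hω'.euclidean_apply (l + 2))).sub
      ((hω.euclidean_apply (l + 2)).mul (hω'.euclidean_apply (l + 1)))).congr_deriv ?_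
    simp only [crossE]
    ring
  have hr (l : Fin 3) := (hcr l).mul (hasDerivAt_comp_curve (r := r) (t := t)
    ((contDiff_rotE hf l).differentiable (by simp)) hω hn)
  have hD := ((HasDerivAt.fun_sum fun i (_ : i ∈ Finset.univ) => hp i).const_mul t).add
    (HasDerivAt.fun_sum fun l (_ : l ∈ Finset.univ) => hr l)
  refine ⟨_, hD, ?_⟩
  simp only [Finset.sum_add_distrib, ← hy]
  have b1 : |∑ i, ω' s i * pdE i f y| ≤ 3 * (2 * G) :=
    sum_mul_abs_le (fun i => (PiLp.norm_apply_le (ω' s) i).trans h1) (abs_pdE_le f y)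
  have b2 : |∑ i, ω s i * curveDeriv t (ω s) (ω' s) (pdE i f) y|
      ≤ 3 * (1 * (3 * (3 * G) + 3 * (2 * 2 * (3 * G)))) :=
    sum_mul_abs_le (fun i => hn s ▸ PiLp.norm_apply_le (ω s) i) fun i =>
      abs_curveDeriv_le ht (hn s) h1
        (fun j => (abs_pdE_pdE_le y hf j i).trans (by linarith))
        (fun l => (abs_rotE_pdE_le f y l i).trans (by linarith))
  have b3 : |∑ l, crossE (ω s) (ω'' s) l * rotE l f y| ≤ 3 * (2 * 2 * G) :=
    sum_mul_abs_le (abs_crossE_le (hn s) h2) (abs_rotE_le f y)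
  have b4 : |∑ l, crossE (ω s) (ω' s) l * curveDeriv t (ω s) (ω' s) (rotE l f) y|
      ≤ 3 * (2 * 2 * (3 * (3 * G) + 3 * (2 * 2 * (3 * G)))) :=
    sum_mul_abs_le (abs_crossE_le (hn s) h1) fun l =>
      abs_curveDeriv_le ht (hn s) h1 (fun j => abs_pdE_rotE_le y hf j l)
        (fun m => abs_rotE_rotE_le y hf m l)
  refine (abs_add_le _ _).trans ?_
  have b12 := (abs_add_le _ _).trans (add_le_add b1 b2)
  have b34 := (abs_add_le _ _).trans (add_le_add b3 b4)
  rw [abs_mul]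
  have := mul_le_mul ht b12 (abs_nonneg _) zero_le_one
  linarith

lemma abs_le_of_second_deriv_bound {g g' : ℝ → ℝ} {M : ℝ → ℝ} (hM : Continuous M)
    (hg : ∀ s, HasDerivAt g (g' s) s)
    (hg' : ∀ s ∈ Set.Icc (0 : ℝ) 1, ∃ D, HasDerivAt g' D s ∧ |D| ≤ M s) :
    |g 0| ≤ |g 1| + |g' 1| + ∫ s in (0 : ℝ)..1, s * M s := by
  choose! D hD hDM using hg'
  have hk (s : ℝ) (hs : s ∈ Set.Icc (0 : ℝ) 1) :
      HasDerivAt (fun s => g s - s * g' s - g 0) (-(s * D s)) s :=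
    (((hg s).sub ((hasDerivAt_id s).mul (hD s hs))).sub_const (g 0)).congr_deriv (by simp)
  have hc : Continuous fun s => s * M s := continuous_id.mul hM
  have key := image_norm_le_of_norm_deriv_right_le_deriv_boundary
    (f := fun s => g s - s * g' s - g 0) (a := 0) (b := 1)
    (B := fun s => ∫ τ in (0 : ℝ)..s, τ * M τ) (B' := fun s => s * M s)
    (fun s hs => (hk s hs).continuousAt.continuousWithinAt)
    (fun s hs => (hk s (Set.Ico_subset_Icc_self hs)).hasDerivWithinAt)
    (by simp) (fun s => (hc.integral_hasStrictDerivAt 0 s).hasDerivAt)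
    (fun s hs => by
      rw [norm_neg, norm_mul, Real.norm_of_nonneg hs.1]
      exact mul_le_mul_of_nonneg_left (hDM s (Set.Ico_subset_Icc_self hs)) hs.1)
    (Set.right_mem_Icc.2 zero_le_one)
  simp only [one_mul, Real.norm_eq_abs] at key
  have e : g 0 = g 1 - g' 1 - (g 1 - g' 1 - g 0) := by ring
  calc |g 0| = |g 1 - g' 1 - (g 1 - g' 1 - g 0)| := by rw [← e]
    _ ≤ |g 1 - g' 1| + |g 1 - g' 1 - g 0| := abs_sub _ _
    _ ≤ _ := add_le_add (abs_sub _ _) key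

/-- Second-order Taylor estimate along a curve of constant radial speed. -/
lemma abs_apply_le_along_curve {f : EuclideanSpace ℝ (Fin 3) → ℝ}
    (hf : ContDiff ℝ (⊤ : ℕ∞) f) (ht : |t| ≤ 1)
    (hω : ∀ s, HasDerivAt ω (ω' s) s) (hω' : ∀ s, HasDerivAt ω' (ω'' s) s)
    (hn : ∀ s, ‖ω s‖ = 1) (h1 : ∀ s, ‖ω' s‖ ≤ 2) (h2 : ∀ s, ‖ω'' s‖ ≤ 2) :
    |f (r • ω 0)| ≤ 1000 * (pointEnergy f ((r + t) • ω 1)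
      + ∫ s in (0 : ℝ)..1, s * pointEnergy f ((r + s * t) • ω s)) := by
  have hc : Continuous ω := continuous_iff_continuousAt.2 fun s => (hω s).continuousAt
  have hM : Continuous fun s => 1000 * pointEnergy f ((r + s * t) • ω s) :=
    continuous_const.mul ((continuous_pointEnergy hf).comp (by fun_prop))
  have h := abs_le_of_second_deriv_bound (g := fun s => f ((r + s * t) • ω s)) hM
    (fun s => hasDerivAt_comp_curve (hf.differentiable (by simp)) (hω s) hn)
    (fun s _ => exists_second_deriv_along_curve hf ht (hω s) (hω' s) hn (h1 s) (h2 s))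
  simp only [zero_mul, add_zero, one_mul] at h
  have e : ∫ s in (0 : ℝ)..1, s * (1000 * pointEnergy f ((r + s * t) • ω s))
      = 1000 * ∫ s in (0 : ℝ)..1, s * pointEnergy f ((r + s * t) • ω s) := by
    rw [← intervalIntegral.integral_const_mul]
    exact intervalIntegral.integral_congr fun s _ => by ring
  have a1 := abs_le_pointEnergy f ((r + t) • ω 1)
  have a2 := abs_curveDeriv_le ht (hn 1) (h1 1) (abs_pdE_le f ((r + t) • ω 1))
    (abs_rotE_le f ((r + t) • ω 1))
  have a3 := pointEnergy_nonneg f ((r + t) • ω 1)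
  rw [e] at h
  linarith

end Curves

section Averaging

open MeasureTheory

lemma lintegral_ball_comp_smul_le {h : EuclideanSpace ℝ (Fin 3) → ENNReal} (hh : Measurable h)
    {s : ℝ} (hs : s ∈ Set.Ioc (0 : ℝ) 1) (δ : ℝ) :
    ∫⁻ u in Metric.ball 0 δ, h (s • u)
      ≤ ENNReal.ofReal (s ^ 3)⁻¹ * ∫⁻ u in Metric.ball 0 δ, h u := by
  set B : Set (EuclideanSpace ℝ (Fin 3)) := Metric.ball 0 δ
  have hB : MeasurableSet B := Metric.isOpen_ball.measurableSet
  calc ∫⁻ u in B, h (s • u)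
      = ∫⁻ u, B.indicator (fun u => h (s • u)) u := (lintegral_indicator hB _).symm
    _ ≤ ∫⁻ u, B.indicator h (s • u) := by
        refine lintegral_mono fun u => ?_
        by_cases hu : u ∈ B
        · have hsu : s • u ∈ B := by
            simp only [B, mem_ball_zero_iff, norm_smul, Real.norm_of_nonneg hs.1.le] at hu ⊢
            exact (mul_le_of_le_one_left (norm_nonneg u) hs.2).trans_lt hu
          simp [hu, hsu]
        · simp [hu]
    _ = ∫⁻ u, B.indicator h u ∂(Measure.map (s • ·) volume) :=
        (lintegral_map (hh.indicator hB) (measurable_const_smul s)).symm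
    _ = ENNReal.ofReal (s ^ 3)⁻¹ * ∫⁻ u in B, h u := by
        rw [Measure.map_addHaar_smul _ hs.1.ne', lintegral_smul_measure, lintegral_indicator hB,
          finrank_euclideanSpace_fin, abs_of_pos (inv_pos.2 (pow_pos hs.1 3)), smul_eq_mul]

lemma lintegral_le_sqrt_measure_mul {α : Type*} [MeasurableSpace α] {μ : Measure α}
    {h : α → ENNReal} (hh : AEMeasurable h μ) :
    ∫⁻ u, h u ∂μ ≤ μ Set.univ ^ (1 / 2 : ℝ) * (∫⁻ u, h u ^ 2 ∂μ) ^ (1 / 2 : ℝ) := by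
  have := ENNReal.lintegral_mul_le_Lp_mul_Lq μ Real.HolderConjugate.two_two
    (aemeasurable_const (b := (1 : ENNReal))) hh
  simpa using this

lemma lintegral_sqrt_inv :
    ∫⁻ s in Set.Ioc (0 : ℝ) 1, ENNReal.ofReal (s ^ (-(1 / 2) : ℝ)) = 2 := by
  have hi : IntervalIntegrable (fun s : ℝ => s ^ (-(1 / 2) : ℝ)) volume 0 1 :=
    intervalIntegral.intervalIntegrable_rpow' (by norm_num)
  rw [← ofReal_integral_eq_lintegral_ofReal
    ((intervalIntegrable_iff_integrableOn_Ioc_of_le zero_le_one).1 hi)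
    ((ae_restrict_mem measurableSet_Ioc).mono fun s hs => Real.rpow_nonneg hs.1.le _),
    ← intervalIntegral.integral_of_le zero_le_one, integral_rpow (by norm_num)]
  norm_num

lemma lintegral_dilation_average_le {h : EuclideanSpace ℝ (Fin 3) → ENNReal}
    (hh : Measurable h) (δ : ℝ) :
    ∫⁻ s in Set.Ioc (0 : ℝ) 1, ENNReal.ofReal s * ∫⁻ u in Metric.ball 0 δ, h (s • u)
      ≤ 2 * (volume (Metric.ball (0 : EuclideanSpace ℝ (Fin 3)) δ) ^ (1 / 2 : ℝ)
        * (∫⁻ u in Metric.ball 0 δ, h u ^ 2) ^ (1 / 2 : ℝ)) := by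
  set B : Set (EuclideanSpace ℝ (Fin 3)) := Metric.ball 0 δ
  set N := volume B ^ (1 / 2 : ℝ) * (∫⁻ u in B, h u ^ 2) ^ (1 / 2 : ℝ) with hN
  have hs (s : ℝ) (hs : s ∈ Set.Ioc (0 : ℝ) 1) :
      ENNReal.ofReal s * ∫⁻ u in B, h (s • u) ≤ ENNReal.ofReal (s ^ (-(1 / 2) : ℝ)) * N := by
    have h1 := lintegral_le_sqrt_measure_mul (μ := volume.restrict B)
      (hh.comp (measurable_const_smul s)).aemeasurable
    rw [Measure.restrict_apply_univ] at h1
    have h2 := lintegral_ball_comp_smul_le (hh.pow_const 2) hs δ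
    have e : s * ((s ^ 3)⁻¹) ^ (1 / 2 : ℝ) = s ^ (-(1 / 2) : ℝ) := by
      rw [← Real.rpow_natCast, ← Real.rpow_neg hs.1.le, ← Real.rpow_mul hs.1.le]
      nth_rewrite 1 [← Real.rpow_one s]
      rw [← Real.rpow_add hs.1]
      norm_num
    calc ENNReal.ofReal s * ∫⁻ u in B, h (s • u)
        ≤ ENNReal.ofReal s * (volume B ^ (1 / 2 : ℝ)
          * (ENNReal.ofReal (s ^ 3)⁻¹ * ∫⁻ u in B, h u ^ 2) ^ (1 / 2 : ℝ)) := by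
          refine mul_le_mul_right (h1.trans ?_) _
          gcongr
          exact h2
      _ = ENNReal.ofReal (s ^ (-(1 / 2) : ℝ)) * N := by
          rw [ENNReal.mul_rpow_of_nonneg _ _ (by norm_num),
            ENNReal.ofReal_rpow_of_nonneg (inv_nonneg.2 (pow_nonneg hs.1.le 3)) (by norm_num),
            ← e, ENNReal.ofReal_mul hs.1.le, hN]
          ring
  calc _ ≤ ∫⁻ s in Set.Ioc (0 : ℝ) 1, ENNReal.ofReal (s ^ (-(1 / 2) : ℝ)) * N :=
        setLIntegral_mono' measurableSet_Ioc hs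
    _ = 2 * N := by
        rw [lintegral_mul_const _ (by fun_prop), lintegral_sqrt_inv]

end Averaging

section SphericalChart

open MeasureTheory

/-- The unit vector of latitude `θ` and longitude `φ`. -/
noncomputable def sphereVec (θ φ : ℝ) : EuclideanSpace ℝ (Fin 3) :=
  !₂[Real.cos θ * Real.cos φ, Real.cos θ * Real.sin φ, Real.sin θ]

lemma norm_sphereVec (θ φ : ℝ) : ‖sphereVec θ φ‖ = 1 := by
  rw [EuclideanSpace.norm_eq, Real.sqrt_eq_one, Fin.sum_univ_three]
  simp only [sphereVec, Real.norm_eq_abs, sq_abs]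
  simp
  linear_combination (Real.cos θ) ^ 2 * Real.sin_sq_add_cos_sq φ + Real.sin_sq_add_cos_sq θ

/-- Spherical coordinates `(t, θ, φ)`, with `t` the radius measured from `r`. -/
noncomputable def sphereChart (r : ℝ) (u : EuclideanSpace ℝ (Fin 3)) :
    EuclideanSpace ℝ (Fin 3) :=
  (r + u 0) • sphereVec (u 1) (u 2)

/-- The Jacobian matrix of `sphereChart r`. -/
noncomputable def sphereJacobian (r : ℝ) (u : EuclideanSpace ℝ (Fin 3)) :
    Matrix (Fin 3) (Fin 3) ℝ :=
  !![Real.cos (u 1) * Real.cos (u 2), -(r + u 0) * Real.sin (u 1) * Real.cos (u 2),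
      -(r + u 0) * Real.cos (u 1) * Real.sin (u 2);
    Real.cos (u 1) * Real.sin (u 2), -(r + u 0) * Real.sin (u 1) * Real.sin (u 2),
      (r + u 0) * Real.cos (u 1) * Real.cos (u 2);
    Real.sin (u 1), (r + u 0) * Real.cos (u 1), 0]

lemma det_sphereJacobian (r : ℝ) (u : EuclideanSpace ℝ (Fin 3)) :
    (sphereJacobian r u).det = -((r + u 0) ^ 2 * Real.cos (u 1)) := by
  rw [sphereJacobian, Matrix.det_fin_three]
  simp
  have h1 := Real.sin_sq_add_cos_sq (u 1)
  have h2 := Real.sin_sq_add_cos_sq (u 2)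
  linear_combination (-(r + u 0) ^ 2 * Real.cos (u 1) *
    (Real.cos (u 1) ^ 2 + Real.sin (u 1) ^ 2)) * h2 - ((r + u 0) ^ 2 * Real.cos (u 1)) * h1

lemma hasFDerivAt_sphereChart (r : ℝ) (u : EuclideanSpace ℝ (Fin 3)) :
    HasFDerivAt (sphereChart r)
      (LinearMap.toContinuousLinearMap (Matrix.toEuclideanLin (sphereJacobian r u))) u := by
  have hc (i : Fin 3) : HasFDerivAt (fun u : EuclideanSpace ℝ (Fin 3) => u i)
      (EuclideanSpace.proj i : EuclideanSpace ℝ (Fin 3) →L[ℝ] ℝ) u :=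
    (EuclideanSpace.proj i : EuclideanSpace ℝ (Fin 3) →L[ℝ] ℝ).hasFDerivAt
  have hρ := (hc 0).const_add r
  rw [← hasFDerivWithinAt_univ, hasFDerivWithinAt_euclidean]
  intro i
  rw [hasFDerivWithinAt_univ]
  fin_cases i
  · refine (hρ.mul ((hc 1).cos.mul (hc 2).cos)).congr_fderiv ?_
    ext v
    simp [sphereJacobian, Matrix.toLpLin_apply, dotProduct, Fin.sum_univ_three]
    ring
  · refine (hρ.mul ((hc 1).cos.mul (hc 2).sin)).congr_fderiv ?_
    ext v
    simp [sphereJacobian, Matrix.toLpLin_apply, dotProduct, Fin.sum_univ_three]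
    ring
  · refine (hρ.mul (hc 1).sin).congr_fderiv ?_
    ext v
    simp [sphereJacobian, Matrix.toLpLin_apply, dotProduct, Fin.sum_univ_three]
    ring

lemma det_fderiv_sphereChart (r : ℝ) (u : EuclideanSpace ℝ (Fin 3)) :
    (LinearMap.toContinuousLinearMap (Matrix.toEuclideanLin (sphereJacobian r u))).det
      = -((r + u 0) ^ 2 * Real.cos (u 1)) := by
  rw [← det_sphereJacobian]
  exact LinearMap.det_toLin (PiLp.basisFun 2 ℝ (Fin 3)) _

lemma abs_apply_lt_of_mem_ball {u : EuclideanSpace ℝ (Fin 3)} {δ : ℝ}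
    (hu : u ∈ Metric.ball 0 δ) (i : Fin 3) : |u i| < δ :=
  (PiLp.norm_apply_le u i).trans_lt (mem_ball_zero_iff.1 hu)

lemma norm_sphereChart {r : ℝ} {u : EuclideanSpace ℝ (Fin 3)} (h : 0 ≤ r + u 0) :
    ‖sphereChart r u‖ = r + u 0 := by
  rw [sphereChart, norm_smul, norm_sphereVec, mul_one, Real.norm_of_nonneg h]

lemma injOn_sphereChart {r : ℝ} (hr : 1 / 2 ≤ r) :
    Set.InjOn (sphereChart r) (Metric.ball 0 (1 / 8)) := by
  intro u hu v hv huv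
  have bu (i) := abs_lt.1 (abs_apply_lt_of_mem_ball hu i)
  have bv (i) := abs_lt.1 (abs_apply_lt_of_mem_ball hv i)
  have hπ := Real.pi_gt_three
  have pu : 0 < r + u 0 := by linarith [bu 0]
  have pv : 0 < r + v 0 := by linarith [bv 0]
  have h0 : r + u 0 = r + v 0 := by
    rw [← norm_sphereChart pu.le, ← norm_sphereChart pv.le, huv]
  have hvec : sphereVec (u 1) (u 2) = sphereVec (v 1) (v 2) := by
    rw [sphereChart, sphereChart, h0] at huv
    exact smul_right_injective _ pv.ne' huv
  have e1 : Real.sin (u 1) = Real.sin (v 1) := by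
    simpa [sphereVec] using congrArg (fun w : EuclideanSpace ℝ (Fin 3) => w 2) hvec
  have h1 : u 1 = v 1 := Real.injOn_sin ⟨by linarith [bu 1], by linarith [bu 1]⟩
    ⟨by linarith [bv 1], by linarith [bv 1]⟩ e1
  have hcos : Real.cos (v 1) ≠ 0 :=
    (Real.cos_pos_of_mem_Ioo ⟨by linarith [bv 1], by linarith [bv 1]⟩).ne'
  have e2 : Real.cos (u 1) * Real.sin (u 2) = Real.cos (v 1) * Real.sin (v 2) := by
    simpa [sphereVec] using congrArg (fun w : EuclideanSpace ℝ (Fin 3) => w 1) hvec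
  rw [h1] at e2
  have h2 : u 2 = v 2 := Real.injOn_sin ⟨by linarith [bu 2], by linarith [bu 2]⟩
    ⟨by linarith [bv 2], by linarith [bv 2]⟩ (mul_left_cancel₀ hcos e2)
  ext i
  fin_cases i
  · exact add_left_cancel h0
  · exact h1
  · exact h2

/-- The spherical chart at radius comparable to `R` distorts volume by at least `R² / 8`. -/
lemma lintegral_comp_sphereChart_le {r R : ℝ} (hR : 1 ≤ R) (hr : R / 2 < r) (hr' : r < R)
    (h : EuclideanSpace ℝ (Fin 3) → ENNReal) :
    ENNReal.ofReal (R ^ 2 / 8) * ∫⁻ u in Metric.ball 0 (1 / 8), h (sphereChart r u)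
      ≤ ∫⁻ y in {y : EuclideanSpace ℝ (Fin 3) | R / 4 < ‖y‖ ∧ ‖y‖ < 2 * R}, h y := by
  set B : Set (EuclideanSpace ℝ (Fin 3)) := Metric.ball 0 (1 / 8)
  have hB : MeasurableSet B := Metric.isOpen_ball.measurableSet
  have himage : sphereChart r '' B ⊆ {y | R / 4 < ‖y‖ ∧ ‖y‖ < 2 * R} := by
    rintro _ ⟨u, hu, rfl⟩
    have bu := abs_lt.1 (abs_apply_lt_of_mem_ball hu 0)
    rw [Set.mem_ofPred_eq, norm_sphereChart (by linarith)]
    constructor <;> linarith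
  rw [← lintegral_const_mul' _ _ ENNReal.ofReal_ne_top]
  refine le_trans ?_ (lintegral_mono_set himage)
  rw [lintegral_image_eq_lintegral_abs_det_fderiv_mul volume hB
    (fun u _ => (hasFDerivAt_sphereChart r u).hasFDerivWithinAt)
    (injOn_sphereChart (by linarith))]
  refine setLIntegral_mono' hB fun u hu => ?_
  gcongr
  have bu (i) := abs_lt.1 (abs_apply_lt_of_mem_ball hu i)
  have hcos : 8 / 9 ≤ Real.cos (u 1) := by
    have := Real.one_sub_sq_div_two_le_cos (x := u 1)
    nlinarith [bu 1]
  have hρ : 3 / 8 * R ≤ r + u 0 := by linarith [bu 0]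
  rw [det_fderiv_sphereChart, abs_neg, abs_of_nonneg (by positivity)]
  nlinarith [mul_le_mul hρ hρ (by positivity) (by linarith), sq_nonneg (r + u 0)]

end SphericalChart

section SphericalCurves

open MeasureTheory

lemma HasDerivAt.of_euclidean_apply {ω : ℝ → EuclideanSpace ℝ (Fin 3)}
    {v : EuclideanSpace ℝ (Fin 3)} {s : ℝ} (h : ∀ i, HasDerivAt (fun s => ω s i) (v i) s) :
    HasDerivAt ω v s := by
  rw [hasDerivAt_iff_hasFDerivAt, ← hasFDerivWithinAt_univ, hasFDerivWithinAt_euclidean]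
  intro i
  rw [hasFDerivWithinAt_univ]
  refine (h i).hasFDerivAt.congr_fderiv ?_
  ext
  simp

lemma norm_le_two_of_abs_le_one {v : EuclideanSpace ℝ (Fin 3)} (hv : ∀ i, |v i| ≤ 1) :
    ‖v‖ ≤ 2 := by
  rw [EuclideanSpace.norm_eq, Real.sqrt_le_left zero_le_two, Fin.sum_univ_three]
  simp only [Real.norm_eq_abs]
  have h (i) : |v i| ^ 2 ≤ 1 := pow_le_one₀ (abs_nonneg _) (hv i)
  linarith [h 0, h 1, h 2]

lemma abs_mul_le_one {a b : ℝ} (ha : |a| ≤ 1) (hb : |b| ≤ 1) : |a * b| ≤ 1 :=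
  abs_mul a b ▸ mul_le_one₀ ha (abs_nonneg b) hb

lemma exists_deriv_sphereVec {a b : ℝ} (ha : |a| ≤ 1 / 8) (hb : |b| ≤ 1 / 8) :
    ∃ ω' ω'' : ℝ → EuclideanSpace ℝ (Fin 3),
      (∀ s, HasDerivAt (fun s => sphereVec (s * a) (s * b)) (ω' s) s) ∧
      (∀ s, HasDerivAt ω' (ω'' s) s) ∧ (∀ s, ‖ω' s‖ ≤ 2) ∧ (∀ s, ‖ω'' s‖ ≤ 2) := by
  have hl (c s : ℝ) : HasDerivAt (fun s : ℝ => s * c) c s := by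
    simpa using (hasDerivAt_id s).mul_const c
  have key {p q p' q' A B : ℝ} (hA : |A| ≤ 1 / 4) (hB : |B| ≤ 1 / 4) (hp : |p| ≤ 1)
      (hq : |q| ≤ 1) (hp' : |p'| ≤ 1) (hq' : |q'| ≤ 1) :
      |A * (p * q) + B * (p' * q')| ≤ 1 := by
    have h1 := abs_mul_le_one hp hq
    have h2 := abs_mul_le_one hp' hq'
    refine (abs_add_le _ _).trans ?_
    rw [abs_mul A, abs_mul B]
    nlinarith [abs_nonneg A, abs_nonneg B, abs_nonneg (p * q), abs_nonneg (p' * q')]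
  have sn := Real.abs_sin_le_one
  have cs := Real.abs_cos_le_one
  have a1 := abs_le.1 ha
  have b1 := abs_le.1 hb
  have hA : |-a| ≤ 1 / 4 := by rw [abs_le]; constructor <;> linarith
  have hA' : |a| ≤ 1 / 4 := by linarith
  have hB : |-b| ≤ 1 / 4 := by rw [abs_le]; constructor <;> linarith
  have hB' : |b| ≤ 1 / 4 := by linarith
  have hAB : |-(a ^ 2 + b ^ 2)| ≤ 1 / 4 := by rw [abs_le]; constructor <;> nlinarith
  have hab : |2 * a * b| ≤ 1 / 4 := by rw [abs_le]; constructor <;> nlinarith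
  have hab' : |-(2 * a * b)| ≤ 1 / 4 := by rwa [abs_neg]
  have haa : |-(a ^ 2)| ≤ 1 / 4 := by rw [abs_le]; constructor <;> nlinarith
  have z : |(0 : ℝ)| ≤ 1 / 4 := by norm_num
  refine ⟨fun s => !₂[-a * (Real.sin (s * a) * Real.cos (s * b))
        + -b * (Real.cos (s * a) * Real.sin (s * b)),
      -a * (Real.sin (s * a) * Real.sin (s * b))
        + b * (Real.cos (s * a) * Real.cos (s * b)), a * Real.cos (s * a)],
    fun s => !₂[-(a ^ 2 + b ^ 2) * (Real.cos (s * a) * Real.cos (s * b))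
        + 2 * a * b * (Real.sin (s * a) * Real.sin (s * b)),
      -(a ^ 2 + b ^ 2) * (Real.cos (s * a) * Real.sin (s * b))
        + -(2 * a * b) * (Real.sin (s * a) * Real.cos (s * b)), -(a ^ 2) * Real.sin (s * a)],
    fun s => HasDerivAt.of_euclidean_apply fun i => ?_,
    fun s => HasDerivAt.of_euclidean_apply fun i => ?_,
    fun s => norm_le_two_of_abs_le_one fun i => ?_,
    fun s => norm_le_two_of_abs_le_one fun i => ?_⟩
  · fin_cases i
    · exact ((hl a s).cos.mul (hl b s).cos).congr_deriv (by simp; ring)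
    · exact ((hl a s).cos.mul (hl b s).sin).congr_deriv (by simp; ring)
    · exact (hl a s).sin.congr_deriv (by simp; ring)
  · fin_cases i
    · exact ((((hl a s).sin.mul (hl b s).cos).const_mul (-a)).add
        (((hl a s).cos.mul (hl b s).sin).const_mul (-b))).congr_deriv (by simp; ring)
    · exact ((((hl a s).sin.mul (hl b s).sin).const_mul (-a)).add
        (((hl a s).cos.mul (hl b s).cos).const_mul b)).congr_deriv (by simp; ring)
    · exact ((hl a s).cos.const_mul a).congr_deriv (by simp; ring)
  · fin_cases i
    · exact key hA hB (sn _) (cs _) (cs _) (sn _)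
    · exact key hA hB' (sn _) (sn _) (cs _) (cs _)
    · exact abs_mul_le_one (by linarith) (cs _)
  · fin_cases i
    · exact key hAB hab (cs _) (cs _) (sn _) (sn _)
    · exact key hAB hab' (cs _) (sn _) (sn _) (cs _)
    · exact abs_mul_le_one (by linarith) (sn _)

lemma exists_rotation_sphereVec {x : EuclideanSpace ℝ (Fin 3)} (hx : 0 < ‖x‖) :
    ∃ Q : EuclideanSpace ℝ (Fin 3) ≃ₗᵢ[ℝ] EuclideanSpace ℝ (Fin 3),
      ‖x‖ • Q (sphereVec 0 0) = x := by
  have hn : ‖sphereVec 0 0‖ = ‖‖x‖⁻¹ • x‖ := by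
    rw [norm_sphereVec, norm_smul, norm_inv, norm_norm, inv_mul_cancel₀ hx.ne']
  refine ⟨Submodule.reflection (Submodule.span ℝ {sphereVec 0 0 - ‖x‖⁻¹ • x})ᗮ, ?_⟩
  rw [Submodule.reflection_sub hn, smul_inv_smul₀ hx.ne']

/-- Taylor estimate along the curves `s ↦ Q (sphereChart ‖x‖ (s • u))` issuing from `x`. -/
lemma ofReal_abs_apply_le {f : EuclideanSpace ℝ (Fin 3) → ℝ} (hf : ContDiff ℝ (⊤ : ℕ∞) f)
    {x : EuclideanSpace ℝ (Fin 3)}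
    {Q : EuclideanSpace ℝ (Fin 3) ≃ₗᵢ[ℝ] EuclideanSpace ℝ (Fin 3)}
    (hQ : ‖x‖ • Q (sphereVec 0 0) = x) {u : EuclideanSpace ℝ (Fin 3)}
    (hu : u ∈ Metric.ball 0 (1 / 8)) :
    ENNReal.ofReal |f x| ≤ 1000 * (ENNReal.ofReal (pointEnergy f (Q (sphereChart ‖x‖ u)))
      + ∫⁻ s in Set.Ioc (0 : ℝ) 1, ENNReal.ofReal s
        * ENNReal.ofReal (pointEnergy f (Q (sphereChart ‖x‖ (s • u))))) := by
  have bu := abs_apply_lt_of_mem_ball hu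
  obtain ⟨ω', ω'', h1, h2, n1, n2⟩ := exists_deriv_sphereVec (bu 1).le (bu 2).le
  have hQd {ω : ℝ → EuclideanSpace ℝ (Fin 3)} {v : EuclideanSpace ℝ (Fin 3)} {s : ℝ}
      (h : HasDerivAt ω v s) : HasDerivAt (fun s => Q (ω s)) (Q v) s :=
    Q.toContinuousLinearEquiv.hasFDerivAt.comp_hasDerivAt s h
  have h := abs_apply_le_along_curve (r := ‖x‖) (t := u 0) hf ((bu 0).le.trans (by norm_num))
    (fun s => hQd (h1 s)) (fun s => hQd (h2 s))
    (fun s => (Q.norm_map _).trans (norm_sphereVec _ _))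
    (fun s => (Q.norm_map _).trans_le (n1 s)) (fun s => (Q.norm_map _).trans_le (n2 s))
  have e (s : ℝ) : (‖x‖ + s * u 0) • Q (sphereVec (s * u 1) (s * u 2))
      = Q (sphereChart ‖x‖ (s • u)) := by
    simp [sphereChart]
  have e1 := e 1
  simp only [one_mul, one_smul] at e1
  simp only [e] at h
  simp only [zero_mul, one_mul, hQ, e1] at h
  have hc : Continuous fun s : ℝ => s * pointEnergy f (Q (sphereChart ‖x‖ (s • u))) := by
    have : Continuous (sphereChart ‖x‖) :=
      continuous_iff_continuousAt.2 fun v => (hasFDerivAt_sphereChart ‖x‖ v).continuousAt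
    have := continuous_pointEnergy hf
    fun_prop
  refine (ENNReal.ofReal_le_ofReal h).trans ?_
  rw [ENNReal.ofReal_mul (by norm_num)]
  have hnn : ∀ s ∈ Set.Ioc (0 : ℝ) 1,
      0 ≤ s * pointEnergy f (Q (sphereChart ‖x‖ (s • u))) := fun s hs =>
    mul_nonneg hs.1.le (pointEnergy_nonneg _ _)
  gcongr
  · simp
  · refine ENNReal.ofReal_add_le.trans ?_
    gcongr
    rw [intervalIntegral.integral_of_le zero_le_one, ofReal_integral_eq_lintegral_ofReal
      (hc.integrableOn_Ioc) ((ae_restrict_mem measurableSet_Ioc).mono hnn)]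
    refine le_of_eq (setLIntegral_congr_fun measurableSet_Ioc fun s hs => ?_)
    exact ENNReal.ofReal_mul hs.1.le

end SphericalCurves

section WeightedSobolev

open MeasureTheory

lemma ofReal_abs_apply_mul_le {f : EuclideanSpace ℝ (Fin 3) → ℝ}
    (hf : ContDiff ℝ (⊤ : ℕ∞) f) {R : ℝ} (hR : 1 ≤ R) {x : EuclideanSpace ℝ (Fin 3)}
    (h1 : R / 2 < ‖x‖) (h2 : ‖x‖ < R) :
    volume (Metric.ball (0 : EuclideanSpace ℝ (Fin 3)) (1 / 8)) * ENNReal.ofReal |f x|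
      ≤ 3000 * (volume (Metric.ball (0 : EuclideanSpace ℝ (Fin 3)) (1 / 8)) ^ (1 / 2 : ℝ)
        * ((ENNReal.ofReal (R ^ 2 / 8))⁻¹ *
          ∫⁻ y in {y : EuclideanSpace ℝ (Fin 3) | R / 4 < ‖y‖ ∧ ‖y‖ < 2 * R},
            ENNReal.ofReal (pointEnergy f y ^ 2)) ^ (1 / 2 : ℝ)) := by
  obtain ⟨Q, hQ⟩ := exists_rotation_sphereVec (x := x) (by linarith)
  set B : Set (EuclideanSpace ℝ (Fin 3)) := Metric.ball 0 (1 / 8)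
  set A : Set (EuclideanSpace ℝ (Fin 3)) := {y | R / 4 < ‖y‖ ∧ ‖y‖ < 2 * R} with hA
  have hB : MeasurableSet B := Metric.isOpen_ball.measurableSet
  set H : EuclideanSpace ℝ (Fin 3) → ENNReal :=
    fun u => ENNReal.ofReal (pointEnergy f (Q (sphereChart ‖x‖ u))) with hH
  have hHc : Continuous H := by
    have : Continuous (sphereChart ‖x‖) :=
      continuous_iff_continuousAt.2 fun v => (hasFDerivAt_sphereChart ‖x‖ v).continuousAt
    exact ENNReal.continuous_ofReal.comp
      ((continuous_pointEnergy hf).comp (Q.continuous.comp this))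
  have hsm : Measurable fun p : EuclideanSpace ℝ (Fin 3) × ℝ =>
      ENNReal.ofReal p.2 * H (p.2 • p.1) := by
    have := hHc.measurable
    fun_prop
  have hsq : ∫⁻ u in B, H u ^ 2 ≤ (ENNReal.ofReal (R ^ 2 / 8))⁻¹ *
      ∫⁻ y in A, ENNReal.ofReal (pointEnergy f y ^ 2) := by
    have hpos : ENNReal.ofReal (R ^ 2 / 8) ≠ 0 := by
      rw [Ne, ENNReal.ofReal_eq_zero, not_le]
      positivity
    rw [mul_comm, ← div_eq_mul_inv,
      ENNReal.le_div_iff_mul_le (Or.inl hpos) (Or.inl ENNReal.ofReal_ne_top), mul_comm]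
    have hch := lintegral_comp_sphereChart_le hR h1 h2
      fun y => ENNReal.ofReal (pointEnergy f (Q y) ^ 2)
    have hmp := Q.measurePreserving.setLIntegral_comp_preimage_emb
      Q.toHomeomorph.measurableEmbedding (fun y => ENNReal.ofReal (pointEnergy f y ^ 2)) A
    have hpre : Q ⁻¹' A = A := by
      ext y
      simp [hA]
    rw [hpre] at hmp
    rw [← hmp]
    refine le_trans (le_of_eq ?_) hch
    simp only [hH, ENNReal.ofReal_pow (pointEnergy_nonneg _ _)]
    rfl
  calc volume B * ENNReal.ofReal |f x| = ∫⁻ _ in B, ENNReal.ofReal |f x| := by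
        rw [setLIntegral_const, mul_comm]
    _ ≤ ∫⁻ u in B, 1000 * (H u + ∫⁻ s in Set.Ioc (0 : ℝ) 1, ENNReal.ofReal s * H (s • u)) :=
        setLIntegral_mono' hB fun u hu => ofReal_abs_apply_le hf hQ hu
    _ = 1000 * ((∫⁻ u in B, H u)
          + ∫⁻ s in Set.Ioc (0 : ℝ) 1, ENNReal.ofReal s * ∫⁻ u in B, H (s • u)) := by
        rw [lintegral_const_mul' _ _ (by simp), lintegral_add_left hHc.measurable,
          lintegral_lintegral_swap hsm.aemeasurable]
        congr 2
        refine lintegral_congr fun s => ?_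
        rw [lintegral_const_mul' _ _ ENNReal.ofReal_ne_top]
    _ ≤ 1000 * (volume B ^ (1 / 2 : ℝ) * (∫⁻ u in B, H u ^ 2) ^ (1 / 2 : ℝ)
          + 2 * (volume B ^ (1 / 2 : ℝ) * (∫⁻ u in B, H u ^ 2) ^ (1 / 2 : ℝ))) := by
        have h := lintegral_le_sqrt_measure_mul (μ := volume.restrict B)
          hHc.measurable.aemeasurable
        rw [Measure.restrict_apply_univ] at h
        gcongr
        exact lintegral_dilation_average_le hHc.measurable _
    _ = 3000 * (volume B ^ (1 / 2 : ℝ) * (∫⁻ u in B, H u ^ 2) ^ (1 / 2 : ℝ)) := by ring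
    _ ≤ _ := by gcongr

lemma integrableOn_annulus {g : EuclideanSpace ℝ (Fin 3) → ℝ} (hg : Continuous g) (R : ℝ) :
    IntegrableOn g {y : EuclideanSpace ℝ (Fin 3) | R / 4 < ‖y‖ ∧ ‖y‖ < 2 * R} :=
  (hg.continuousOn.integrableOn_compact (isCompact_closedBall 0 (2 * R))).mono_set
    fun _ hy => mem_closedBall_zero_iff.2 hy.2.le

lemma sqrt_integral_pointEnergy_le {f : EuclideanSpace ℝ (Fin 3) → ℝ}
    (hf : ContDiff ℝ (⊤ : ℕ∞) f) (R : ℝ) :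
    √(∫ y in {y : EuclideanSpace ℝ (Fin 3) | R / 4 < ‖y‖ ∧ ‖y‖ < 2 * R}, pointEnergy f y ^ 2)
      ≤ √(orderLeTwo.card) * ∑ p ∈ orderLeTwo,
        √(∫ y in {y : EuclideanSpace ℝ (Fin 3) | R / 4 < ‖y‖ ∧ ‖y‖ < 2 * R},
          rotPdPow p f y ^ 2) := by
  set A : Set (EuclideanSpace ℝ (Fin 3)) := {y | R / 4 < ‖y‖ ∧ ‖y‖ < 2 * R}
  have hi (p) : IntegrableOn (fun y => rotPdPow p f y ^ 2) A :=
    integrableOn_annulus ((contDiff_rotPdPow hf p).continuous.pow 2) R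
  have h : ∫ y in A, pointEnergy f y ^ 2
      ≤ orderLeTwo.card * ∑ p ∈ orderLeTwo, ∫ y in A, rotPdPow p f y ^ 2 := by
    rw [← integral_finsetSum _ fun p _ => hi p, ← integral_const_mul]
    refine setIntegral_mono (integrableOn_annulus ((continuous_pointEnergy hf).pow 2) R)
      ((integrable_finsetSum _ fun p _ => hi p).const_mul _) fun y => ?_
    simpa [pointEnergy] using
      sq_sum_le_card_mul_sum_sq (s := orderLeTwo) (f := fun p => |rotPdPow p f y|)
  refine (Real.sqrt_le_sqrt h).trans ?_
  rw [Real.sqrt_mul (Nat.cast_nonneg _)]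
  gcongr
  rw [Real.sqrt_le_left (Finset.sum_nonneg fun _ _ => Real.sqrt_nonneg _)]
  refine le_trans (Finset.sum_le_sum fun p _ => ?_)
    (Finset.sum_sq_le_sq_sum_of_nonneg fun p _ => Real.sqrt_nonneg _)
  rw [Real.sq_sqrt (integral_nonneg fun y => sq_nonneg _)]

end WeightedSobolev

/-- Klainerman's weighted Sobolev estimate: for `R ≥ 1`,
`sup_{R/2 < |x| < R} |f| ≤ C R⁻¹ ∑_{|α|+|β| ≤ 2} ‖Ω^α ∂^β f‖_{L²(R/4 < |x| < 2R)}`. -/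
theorem weighted_sobolev :
    ∃ C : ℝ, 0 < C ∧ ∀ (f : EuclideanSpace ℝ (Fin 3) → ℝ), ContDiff ℝ (⊤ : ℕ∞) f →
      ∀ R : ℝ, 1 ≤ R → ∀ x : EuclideanSpace ℝ (Fin 3),
        R / 2 < ‖x‖ → ‖x‖ < R →
        |f x| ≤ C * R⁻¹ *
          ∑ p ∈ Finset.univ.filter
              (fun p : (Fin 3 → Fin 3) × (Fin 3 → Fin 3) =>
                (∑ i, (p.1 i : ℕ)) + (∑ i, (p.2 i : ℕ)) ≤ 2),
            Real.sqrt (∫ y in {y : EuclideanSpace ℝ (Fin 3) | R / 4 < ‖y‖ ∧ ‖y‖ < 2 * R},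
              (rotPow (fun i => (p.1 i : ℕ)) (pdPow (fun i => (p.2 i : ℕ)) f) y) ^ 2) := by
  set c : ℝ := (MeasureTheory.volume (Metric.ball (0 : EuclideanSpace ℝ (Fin 3)) (1 / 8))).toReal with hc
  have hfin : MeasureTheory.volume (Metric.ball (0 : EuclideanSpace ℝ (Fin 3)) (1 / 8)) ≠ ⊤ :=
    MeasureTheory.measure_ball_lt_top.ne
  have hc0 : 0 < c := ENNReal.toReal_pos (Metric.measure_ball_pos _ _ (by norm_num)).ne' hfin
  have hcard : 0 < (orderLeTwo.card : ℝ) :=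
    Nat.cast_pos.2 (Finset.card_pos.2 ⟨(0, 0), by decide⟩)
  refine ⟨c⁻¹ * (3000 * (√c * (√8 * √orderLeTwo.card))), by positivity, ?_⟩
  intro f hf R hR x h1 h2
  have hR0 : 0 < R := by linarith
  have hI : 0 ≤ ∫ y in {y : EuclideanSpace ℝ (Fin 3) | R / 4 < ‖y‖ ∧ ‖y‖ < 2 * R},
      pointEnergy f y ^ 2 := MeasureTheory.integral_nonneg fun y => sq_nonneg _
  have hsq_int : MeasureTheory.IntegrableOn (fun y => pointEnergy f y ^ 2)
      {y : EuclideanSpace ℝ (Fin 3) | R / 4 < ‖y‖ ∧ ‖y‖ < 2 * R} :=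
    integrableOn_annulus ((continuous_pointEnergy hf).pow 2) R
  have key := ofReal_abs_apply_mul_le hf hR h1 h2
  rw [← MeasureTheory.ofReal_integral_eq_lintegral_ofReal
      hsq_int
      (Filter.Eventually.of_forall fun y => sq_nonneg _), ← ENNReal.ofReal_toReal hfin, ← hc,
    ← ENNReal.ofReal_inv_of_pos (by positivity), ← ENNReal.ofReal_mul hc0.le,
    ← ENNReal.ofReal_mul (by positivity),
    ENNReal.ofReal_rpow_of_nonneg hc0.le (by norm_num),
    ENNReal.ofReal_rpow_of_nonneg (by positivity) (by norm_num),
    ← ENNReal.ofReal_mul (by positivity), ← ENNReal.ofReal_ofNat,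
    ← ENNReal.ofReal_mul (by positivity), ENNReal.ofReal_le_ofReal_iff (by positivity),
    ← Real.sqrt_eq_rpow, ← Real.sqrt_eq_rpow, Real.sqrt_mul (by positivity), inv_div,
    Real.sqrt_div (by norm_num), Real.sqrt_sq hR0.le] at key
  have hS := sqrt_integral_pointEnergy_le hf R
  change |f x| ≤ _ * R⁻¹ * ∑ p ∈ orderLeTwo,
    √(∫ y in {y : EuclideanSpace ℝ (Fin 3) | R / 4 < ‖y‖ ∧ ‖y‖ < 2 * R}, rotPdPow p f y ^ 2)
  calc |f x| = c⁻¹ * (c * |f x|) := by rw [inv_mul_cancel_left₀ hc0.ne']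
    _ ≤ c⁻¹ * (3000 * (√c * (√8 / R * (√orderLeTwo.card * ∑ p ∈ orderLeTwo,
          √(∫ y in {y : EuclideanSpace ℝ (Fin 3) | R / 4 < ‖y‖ ∧ ‖y‖ < 2 * R},
            rotPdPow p f y ^ 2))))) := by
        refine mul_le_mul_of_nonneg_left (key.trans ?_) (inv_nonneg.2 hc0.le)
        gcongr
    _ = _ := by ring
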